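/- For all integers n ≥ 1 and 1 ≤ r ≤ n, the number of binary trees with exactly n nodes that have exactly r nodes which are either leaves or have a left child but no right child equals the Narayana number N_{n,r} = (1/n)·C(n,r)·C(n,r−1). -/

import Mathlib

inductive BinTree : Type where
  | leaf : BinTree
  | node : BinTree → BinTree → BinTree
deriving DecidableEq

namespace BinTree

def size : BinTree → ℕ
  | leaf => 0
  | node l r => 1 + size l + size r

def height : BinTree → ℕ
  | leaf => 0
  | node l r => 1 + max (height l) (height r)

def subtreeAt : BinTree → List Bool → BinTree
  | t, [] => t
  | leaf, _ :: _ => leaf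
  | node l r, b :: v => subtreeAt (if b then r else l) v

def countGE (b : ℕ) : BinTree → ℕ
  | leaf => 0
  | node l r => (if b ≤ size (node l r) then 1 else 0) + countGE b l + countGE b r

end BinTree

noncomputable def fsProb (p : ℕ → ℕ → ℝ) : BinTree → ℝ
  | .leaf => 1
  | .node l r => p l.size r.size * fsProb p l * fsProb p r

noncomputable def fhProb (p : ℕ → ℕ → ℝ) : BinTree → ℝ
  | .leaf => 1
  | .node l r => p l.height r.height * fhProb p l * fhProb p r

def IsFixedSizeSource (p : ℕ → ℕ → ℝ) : Prop :=
  (∀ ℓ r, 0 ≤ p ℓ r ∧ p ℓ r ≤ 1) ∧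
  ∀ n : ℕ, ∑ ℓ ∈ Finset.range (n + 1), p ℓ (n - ℓ) = 1

def IsFixedHeightSource (p : ℕ → ℕ → ℝ) : Prop :=
  (∀ i j, 0 ≤ p i j ∧ p i j ≤ 1) ∧
  ∀ h : ℕ,
    ∑ ij ∈ (Finset.range (h + 1) ×ˢ Finset.range (h + 1)).filter
        (fun ij => max ij.1 ij.2 = h), p ij.1 ij.2 = 1

/-- The number of nodes of `t` that are leaves or have a left child but no
right child (equivalently: whose right child is absent). -/
def countLeafOrLeftUnary : BinTree → ℕ
  | .leaf => 0
  | .node l r =>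
      (if r = BinTree.leaf then 1 else 0) + countLeafOrLeftUnary l +
        countLeafOrLeftUnary r


namespace Nar

/-- Lists of `k` trees with total size `n` and total count `r`. -/
def S (k n r : ℕ) : Set (List BinTree) :=
  {l | l.length = k ∧ (l.map BinTree.size).sum = n ∧ (l.map countLeafOrLeftUnary).sum = r}

def f2 : List BinTree → List BinTree
  | [] => []
  | a :: l => BinTree.node a BinTree.leaf :: l

def f3 : List BinTree → List BinTree
  | a :: b :: l => BinTree.node a b :: l
  | l => l

def f4 : List BinTree → List BinTree
  | [] => []
  | a :: l => a :: BinTree.leaf :: l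

lemma f2_inj (k n r : ℕ) : Set.InjOn f2 (S (k+1) n r) := by
  rintro (_ | ⟨a, l⟩) h (_ | ⟨b, m⟩) h' e <;> simp_all [S, f2]

lemma f4_inj (k n r : ℕ) : Set.InjOn f4 (S (k+1) n r) := by
  rintro (_ | ⟨a, l⟩) h (_ | ⟨b, m⟩) h' e <;> simp_all [S, f4]

lemma f3_inj (k n r : ℕ) : Set.InjOn f3 (S (k+2) n r) := by
  rintro (_ | ⟨a, _ | ⟨a', l⟩⟩) h (_ | ⟨b, _ | ⟨b', m⟩⟩) h' e <;> simp_all [S, f3]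

lemma cnt_pos (t : BinTree) : t.size = 0 ∨ 1 ≤ countLeafOrLeftUnary t := by
  induction t with
  | leaf => left; rfl
  | node l r ihl ihr =>
    right
    cases r with
    | leaf => simp [countLeafOrLeftUnary]
    | node a b =>
      rcases ihr with h | h
      · simp [BinTree.size] at h
      · rw [countLeafOrLeftUnary]; omega

lemma S_zero_r (k n : ℕ) : S k (n+1) 0 = ∅ := by
  ext l
  simp only [S, Set.mem_setOf_eq, Set.mem_empty_iff_false, iff_false]
  rintro ⟨-, h, h'⟩
  rw [List.sum_eq_zero_iff] at h'
  have : (l.map BinTree.size).sum = 0 := by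
    rw [List.sum_eq_zero_iff]
    intro x hx
    obtain ⟨t, ht, rfl⟩ := List.mem_map.1 hx
    have := h' _ (List.mem_map.2 ⟨t, ht, rfl⟩)
    rcases cnt_pos t with h | h <;> omega
  omega

lemma S_zero_k (n r : ℕ) : S 0 (n+1) r = ∅ := by
  ext l
  simp only [S, Set.mem_setOf_eq, Set.mem_empty_iff_false, iff_false]
  rintro ⟨h, h', -⟩
  rw [List.length_eq_zero_iff] at h
  subst h
  simp at h'

lemma size_zero (t : BinTree) : t.size = 0 ↔ t = .leaf := by
  cases t <;> simp [BinTree.size]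

lemma S_zero_n (k : ℕ) : ∀ r, S k 0 r = if r = 0 then {List.replicate k BinTree.leaf} else ∅ := by
  have key : ∀ l : List BinTree, (l.map BinTree.size).sum = 0 →
      l = List.replicate l.length BinTree.leaf := by
    intro l h
    rw [List.eq_replicate_iff]
    refine ⟨rfl, fun t ht => (size_zero t).1 ?_⟩
    rw [List.sum_eq_zero_iff] at h
    exact h _ (List.mem_map.2 ⟨t, ht, rfl⟩)
  intro r
  split_ifs with hr
  · ext l
    simp only [S, Set.mem_setOf_eq, Set.mem_singleton_iff]
    constructor
    · rintro ⟨h, h', -⟩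
      rw [key l h', h]
    · rintro rfl
      simp [BinTree.size, countLeafOrLeftUnary, hr]
  · ext l
    simp only [S, Set.mem_setOf_eq, Set.mem_empty_iff_false, iff_false]
    rintro ⟨h, h', h''⟩
    rw [key l h'] at h''
    simp [countLeafOrLeftUnary] at h''
    omega

lemma f4_sub (k n r : ℕ) : f4 '' S (k+1) n r ⊆ S (k+2) n r := by
  rintro _ ⟨(_ | ⟨a, l⟩), h, rfl⟩ <;> simp_all [S, f4, BinTree.size, countLeafOrLeftUnary]

lemma S_rec (k n r : ℕ) : S (k+1) (n+1) (r+1) =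
    (List.cons BinTree.leaf '' S k (n+1) (r+1) ∪ f2 '' S (k+1) n r) ∪
      f3 '' (S (k+2) n (r+1) \ f4 '' S (k+1) n (r+1)) := by
  ext l
  constructor
  · rintro ⟨h1, h2, h3⟩
    rcases l with _ | ⟨_ | ⟨a, b⟩, l⟩
    · simp at h1
    · left; left
      refine ⟨l, ⟨?_, ?_, ?_⟩, rfl⟩ <;>
        simp_all [BinTree.size, countLeafOrLeftUnary]
    · by_cases hb : b = .leaf
      · subst hb
        left; right
        refine ⟨a :: l, ⟨?_, ?_, ?_⟩, rfl⟩ <;>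
          simp_all [BinTree.size, countLeafOrLeftUnary] <;> omega
      · right
        refine ⟨a :: b :: l, ⟨⟨?_, ?_, ?_⟩, ?_⟩, rfl⟩
        · simp_all
        · simp_all [BinTree.size]; omega
        · simp_all [countLeafOrLeftUnary]; omega
        · rintro ⟨(_ | ⟨c, m⟩), -, h⟩ <;> simp_all [f4]
  · rintro ((⟨m, ⟨h1, h2, h3⟩, rfl⟩ | ⟨m, ⟨h1, h2, h3⟩, rfl⟩) | ⟨m, ⟨⟨h1, h2, h3⟩, h4⟩, rfl⟩)
    · refine ⟨?_, ?_, ?_⟩ <;> simp_all [BinTree.size, countLeafOrLeftUnary]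
    · rcases m with _ | ⟨a, m⟩
      · simp at h1
      · refine ⟨?_, ?_, ?_⟩ <;> simp_all [f2, BinTree.size, countLeafOrLeftUnary] <;> omega
    · rcases m with _ | ⟨a, _ | ⟨b, m⟩⟩
      · simp at h1
      · simp at h1
      · have hb : b ≠ .leaf := by
          rintro rfl
          apply h4
          refine ⟨a :: m, ⟨?_, ?_, ?_⟩, rfl⟩ <;> simp_all [BinTree.size, countLeafOrLeftUnary]
        refine ⟨?_, ?_, ?_⟩
        · simp_all [f3]
        · simp_all [f3, BinTree.size]; omega
        · simp_all [f3, countLeafOrLeftUnary]; omega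

lemma S_fin (n : ℕ) : ∀ k r, (S k n r).Finite := by
  induction n with
  | zero => intro k r; rw [S_zero_n]; split_ifs <;> simp
  | succ n ih =>
    intro k
    induction k with
    | zero => intro r; rw [S_zero_k]; simp
    | succ k ihk =>
      rintro (_ | r)
      · rw [S_zero_r]; simp
      · rw [S_rec]
        exact (((ihk _).image _).union ((ih _ _).image _)).union (((ih _ _).diff).image _)

lemma card_rec (k n r : ℕ) : ((S (k+1) (n+1) (r+1)).ncard : ℝ) =
    (S k (n+1) (r+1)).ncard + (S (k+1) n r).ncard + (S (k+2) n (r+1)).ncard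
      - (S (k+1) n (r+1)).ncard := by
  have F := S_fin
  have hA := (F (n+1) k (r+1)).image (List.cons BinTree.leaf)
  have hB := (F n (k+1) r).image f2
  have hC := ((F n (k+2) (r+1)).diff (t := f4 '' S (k+1) n (r+1))).image f3
  rw [S_rec, Set.ncard_union_eq _ (hA.union hB) hC, Set.ncard_union_eq _ hA hB,
    Set.ncard_image_of_injective _ List.cons_injective, Set.ncard_image_of_injOn (f2_inj _ _ _),
    Set.ncard_image_of_injOn ((f3_inj _ _ _).mono Set.diff_subset)]
  · have := Set.ncard_diff_add_ncard_of_subset (f4_sub k n (r+1)) (F _ _ _)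
    rw [Set.ncard_image_of_injOn (f4_inj _ _ _)] at this
    rw [← this]
    push_cast
    ring
  · rw [Set.disjoint_left]
    rintro _ ⟨m, -, rfl⟩ ⟨(_ | ⟨a, l⟩), ⟨h1, -⟩, h⟩ <;> simp_all [f2]
  · rw [Set.disjoint_left]
    rintro _ (⟨m, -, rfl⟩ | ⟨m, ⟨h, -⟩, rfl⟩) ⟨l, ⟨⟨h1, h2, h3⟩, h4⟩, e⟩
    · rcases l with _ | ⟨a, _ | ⟨b, l⟩⟩ <;> simp_all [f3]
    · rcases l with _ | ⟨a, _ | ⟨b, l⟩⟩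
      · simp at h1
      · simp at h1
      · rcases m with _ | ⟨c, m⟩
        · simp at h
        · simp only [f3, f2, List.cons.injEq, BinTree.node.injEq] at e
          obtain ⟨⟨rfl, rfl⟩, rfl⟩ := e
          apply h4
          refine ⟨a :: l, ⟨?_, ?_, ?_⟩, rfl⟩ <;> simp_all [BinTree.size, countLeafOrLeftUnary]

lemma ch1 (m s : ℕ) : (m.choose (s+1) : ℝ) = (m - s) * m.choose s / (s+1) := by
  have := Nat.choose_succ_right_eq m s
  rw [eq_div_iff (by positivity)]
  rcases le_or_gt s m with h | h
  · rw [← Nat.cast_sub h]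
    have := congrArg (Nat.cast (R := ℝ)) this
    push_cast at this
    linarith
  · simp [Nat.choose_eq_zero_of_lt h, Nat.choose_eq_zero_of_lt (Nat.lt_succ_of_lt h)]

lemma ch2 (m s : ℕ) : ((m+1).choose (s+1) : ℝ) = (m + 1) * m.choose s / (s+1) := by
  have := congrArg (Nat.cast (R := ℝ)) (Nat.add_one_mul_choose_eq m s)
  push_cast at this
  rw [eq_div_iff (by positivity)]
  linarith

lemma main (n : ℕ) : ∀ k s, ((S k (n+1) (s+1)).ncard : ℝ) =
    k * (n+1).choose (s+1) * (n+k).choose s / (n+1) := by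
  induction n with
  | zero =>
    intro k
    induction k with
    | zero => intro s; rw [S_zero_k]; simp
    | succ k ihk =>
      intro s
      rw [card_rec, ihk, S_zero_n, S_zero_n, S_zero_n]
      rcases s with _ | s <;> simp [Nat.choose_eq_zero_of_lt]
  | succ m ih =>
    intro k
    induction k with
    | zero => intro s; rw [S_zero_k]; simp
    | succ k ihk =>
      rintro (_ | s)
      · rw [card_rec, ihk, S_zero_r, ih, ih]
        simp
        field_simp
        ring
      · rw [card_rec, ihk, ih, ih, ih]
        rw [show m + 1 + (k + 1) = (m+1+k) + 1 by ring, show m + (k+2) = (m+1+k) + 1 by ring,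
          show m + (k+1) = m+1+k by ring, ch2 (m+1) (s+1), ch1 (m+1) (s+1),
          ch2 (m+1+k) s, ch1 (m+1+k) s]
        push_cast
        field_simp
        ring

end Nar

/-- the number of binary trees with `n` nodes of which exactly
`r` are leaves or left-unary equals the Narayana number
`N_{n,r} = (1/n)·C(n,r)·C(n,r-1)`. -/
theorem statement10 (n r : ℕ) (h1 : 1 ≤ r) (h2 : r ≤ n) :
    (Nat.card {t : BinTree // t.size = n ∧ countLeafOrLeftUnary t = r} : ℝ) =
      (n.choose r : ℝ) * (n.choose (r - 1) : ℝ) / (n : ℝ) := by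
  obtain ⟨m, rfl⟩ : ∃ m, n = m + 1 := ⟨n - 1, by omega⟩
  obtain ⟨s, rfl⟩ : ∃ s, r = s + 1 := ⟨r - 1, by omega⟩
  have h := Nar.main m 1 s
  have e : Nar.S 1 (m+1) (s+1) = (fun t => [t]) ''
      {t : BinTree | t.size = m+1 ∧ countLeafOrLeftUnary t = s+1} := by
    ext l
    constructor
    · rintro ⟨h1, h2, h3⟩
      obtain ⟨t, rfl⟩ := List.length_eq_one_iff.1 h1
      exact ⟨t, ⟨by simpa using h2, by simpa using h3⟩, rfl⟩
    · rintro ⟨t, ⟨h1, h2⟩, rfl⟩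
      exact ⟨rfl, by simpa using h1, by simpa using h2⟩
  rw [e, Set.ncard_image_of_injective _ (fun a b h => by simpa using h)] at h
  have h' : Nat.card {t : BinTree // t.size = m+1 ∧ countLeafOrLeftUnary t = s+1} =
    {t : BinTree | t.size = m+1 ∧ countLeafOrLeftUnary t = s+1}.ncard := rfl
  rw [h', h]
  simp
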